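/- arXiv:math/0004118 — 4 statements merged into one kernel-verified Lean document; each statement's English description precedes it below -/
import Mathlib

section
/- Let κ₀, θ₁, η₁, κ ∈ ℂ and set α = (κ₀+θ₁)²/2 − 2κ, β = −κ₀²/2, γ = η₁(θ₁+1), δ = −η₁²/2. Let I ⊆ (0,∞) be an open interval and let q, p : I → ℂ be differentiable with sinh(q(t)/2) ≠ 0 and cosh(q(t)/2) ≠ 0 on I, satisfying the Hamiltonian system t q'(t) = p(t) and t p'(t) = −[ α·cosh(q/2)/sinh³(q/2) + β·sinh(q/2)/cosh³(q/2) + (γt/2)·sinh(q) + (δt²/4)·sinh(2q) ] (the canonical equations t q' = ∂𝓗/∂p, t p' = −∂𝓗/∂q for 𝓗(q,p,t) = p²/2 − α/sinh²(q/2) − β/cosh²(q/2) + (γt/2)cosh(q) + (δt²/8)cosh(2q)). Define s(t) = −coth(q(t)/2), λ(t) = s(t)², and μ(t) = p(t)/(2 s(t)(λ(t)−1)) + (1/2)( κ₀/λ(t) + θ₁/(λ(t)−1) − η₁ t/(λ(t)−1)² ). Then λ and μ are differentiable on I and satisfy the canonical equations λ'(t) = (∂H/∂μ)(λ(t),μ(t),t)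 and μ'(t) = −(∂H/∂λ)(λ(t),μ(t),t) for the polynomial P_V Hamiltonian H(λ,μ,t) = (λ(λ−1)²/t)·[ μ² − ( κ₀/λ + θ₁/(λ−1) − η₁ t/(λ−1)² )·μ + κ/(λ(λ−1)) ]. -/
open Complex

/-- The canonical transformation from the Calogero side of P_V (hyperbolic Inozemtsev
model, rank one) to the polynomial Hamiltonian form of P_V. -/
theorem PV_canonical_transformation
    (κ₀ θ₁ η₁ κ α β γ δ : ℂ)
    (hα : α = (κ₀ + θ₁) ^ 2 / 2 - 2 * κ) (hβ : β = -κ₀ ^ 2 / 2)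
    (hγ : γ = η₁ * (θ₁ + 1)) (hδ : δ = -η₁ ^ 2 / 2)
    (I : Set ℝ) (hI : IsOpen I) (hIpos : I ⊆ Set.Ioi (0 : ℝ))
    (q p q' p' : ℝ → ℂ)
    (hq : ∀ t ∈ I, HasDerivAt q (q' t) t)
    (hp : ∀ t ∈ I, HasDerivAt p (p' t) t)
    (hsinh : ∀ t ∈ I, Complex.sinh (q t / 2) ≠ 0)
    (hcosh : ∀ t ∈ I, Complex.cosh (q t / 2) ≠ 0)
    (heq1 : ∀ t ∈ I, (t : ℂ) * q' t = p t)
    (heq2 : ∀ t ∈ I, (t : ℂ) * p' t =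
        -(α * Complex.cosh (q t / 2) / Complex.sinh (q t / 2) ^ 3
          + β * Complex.sinh (q t / 2) / Complex.cosh (q t / 2) ^ 3
          + γ * (t : ℂ) / 2 * Complex.sinh (q t)
          + δ * (t : ℂ) ^ 2 / 4 * Complex.sinh (2 * q t)))
    (s lam mu : ℝ → ℂ)
    (hs : ∀ t, s t = -(Complex.cosh (q t / 2) / Complex.sinh (q t / 2)))
    (hlam : ∀ t, lam t = s t ^ 2)
    (hmu : ∀ t, mu t = p t / (2 * s t * (lam t - 1))
        + (κ₀ / lam t + θ₁ / (lam t - 1) - η₁ * (t : ℂ) / (lam t - 1) ^ 2) / 2)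
    (H : ℂ → ℂ → ℝ → ℂ)
    (hH : ∀ l m t, H l m t = l * (l - 1) ^ 2 / (t : ℂ) *
        (m ^ 2 - (κ₀ / l + θ₁ / (l - 1) - η₁ * (t : ℂ) / (l - 1) ^ 2) * m
          + κ / (l * (l - 1)))) :
    ∀ t ∈ I,
      HasDerivAt lam (deriv (fun m => H (lam t) m t) (mu t)) t ∧
      HasDerivAt mu (-deriv (fun l => H l (mu t) t) (lam t)) t := by
  intro t ht
  have ht0 : (t : ℂ) ≠ 0 := by exact_mod_cast (hIpos ht).ne'
  have hS := hsinh t ht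
  have hC := hcosh t ht
  have hCS : Complex.cosh (q t / 2) ^ 2 = Complex.sinh (q t / 2) ^ 2 + 1 :=
    Complex.cosh_sq _
  have hs0 : s t ≠ 0 := by
    rw [hs]
    exact neg_ne_zero.mpr (div_ne_zero hC hS)
  have hcosh_eq : Complex.cosh (q t / 2) = -(s t) * Complex.sinh (q t / 2) := by
    rw [hs]
    field_simp
  have hprod : (s t ^ 2 - 1) * Complex.sinh (q t / 2) ^ 2 = 1 := by
    rw [hcosh_eq] at hCS
    linear_combination hCS
  have hs1 : s t ^ 2 - 1 ≠ 0 := left_ne_zero_of_mul_eq_one hprod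
  have hS2 : Complex.sinh (q t / 2) ^ 2 = 1 / (s t ^ 2 - 1) := by
    rw [eq_div_iff hs1]
    linear_combination hprod
  have hsinh_q : Complex.sinh (q t) = -2 * s t / (s t ^ 2 - 1) := by
    have h := Complex.sinh_two_mul (q t / 2)
    rw [mul_div_cancel₀ (q t) (two_ne_zero : (2 : ℂ) ≠ 0), hcosh_eq] at h
    rw [h]
    linear_combination (-2 * s t) * hS2
  have hcosh_q : Complex.cosh (q t) = (s t ^ 2 + 1) / (s t ^ 2 - 1) := by
    have h := Complex.cosh_two_mul (q t / 2)
    rw [mul_div_cancel₀ (q t) (two_ne_zero : (2 : ℂ) ≠ 0), hcosh_eq] at h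
    rw [h]
    linear_combination (s t ^ 2 + 1) * hS2
  have hcs : Complex.cosh (q t / 2) / Complex.sinh (q t / 2) ^ 3 = -(s t) * (s t ^ 2 - 1) := by
    rw [div_eq_iff (pow_ne_zero 3 hS), hcosh_eq]
    linear_combination s t * Complex.sinh (q t / 2) * hprod
  have hsc : Complex.sinh (q t / 2) / Complex.cosh (q t / 2) ^ 3
      = -(s t ^ 2 - 1) / s t ^ 3 := by
    rw [div_eq_div_iff (pow_ne_zero 3 hC) (pow_ne_zero 3 hs0), hcosh_eq]
    linear_combination (-(s t ^ 3) * Complex.sinh (q t / 2)) * hprod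
  have hq' : q' t = p t / t := by
    rw [eq_div_iff ht0]
    linear_combination heq1 t ht
  have hp' : p' t = (α * (s t * (s t ^ 2 - 1)) + β * ((s t ^ 2 - 1) / s t ^ 3)
      + γ * t * (s t / (s t ^ 2 - 1))
      + δ * t ^ 2 * (s t * (s t ^ 2 + 1) / (s t ^ 2 - 1) ^ 2)) / t := by
    rw [eq_div_iff ht0, mul_comm, heq2 t ht, Complex.sinh_two_mul, hsinh_q, hcosh_q,
      mul_div_assoc, mul_div_assoc β, hcs, hsc]
    field_simp
    ring
  have hds : HasDerivAt s ((s t ^ 2 - 1) / 2 * (p t / t)) t := by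
    have hhalf := (hq t ht).div_const 2
    have hdcosh : HasDerivAt (fun x => Complex.cosh (q x / 2))
        (Complex.sinh (q t / 2) * (q' t / 2)) t :=
      (Complex.hasDerivAt_cosh _).comp t hhalf
    have hdsinh : HasDerivAt (fun x => Complex.sinh (q x / 2))
        (Complex.cosh (q t / 2) * (q' t / 2)) t :=
      (Complex.hasDerivAt_sinh _).comp t hhalf
    have h := (hdcosh.fun_div hdsinh hS).fun_neg
    rw [← funext hs] at h
    refine h.congr_deriv ?_
    rw [hq', eq_div_of_mul_eq (pow_ne_zero 2 hS) hprod]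
    field_simp
    linear_combination p t * hCS
  have hdlam : HasDerivAt lam (s t * (s t ^ 2 - 1) * (p t / t)) t := by
    have h := hds.fun_pow 2
    rw [← funext hlam] at h
    refine h.congr_deriv ?_
    push_cast
    ring
  have hl0 : lam t ≠ 0 := by rw [hlam]; exact pow_ne_zero 2 hs0
  have hl1 : lam t - 1 ≠ 0 := by rw [hlam]; exact hs1
  refine ⟨hdlam.congr_deriv ?_, ?_⟩
  · have hHm : HasDerivAt (fun m => H (lam t) m t) (lam t * (lam t - 1) ^ 2 / (t : ℂ) *
        (2 * mu t - (κ₀ / lam t + θ₁ / (lam t - 1) - η₁ * (t : ℂ) / (lam t - 1) ^ 2))) (mu t) := by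
      simp only [hH]
      refine (((((hasDerivAt_id (mu t)).fun_pow 2).fun_sub
        ((hasDerivAt_id (mu t)).const_mul _)).add_const _).const_mul _).congr_deriv ?_
      simp
    rw [hHm.deriv, hmu, hlam]
    field_simp
    ring
  · have hid := hasDerivAt_id (lam t)
    have hid1 := hid.sub_const 1
    have hHl := ((hid.fun_mul (hid1.fun_pow 2)).div_const (t : ℂ)).fun_mul
      (((((((hasDerivAt_const (lam t) κ₀).fun_div hid hl0).fun_add
        ((hasDerivAt_const (lam t) θ₁).fun_div hid1 hl1)).fun_sub
        ((hasDerivAt_const (lam t) (η₁ * (t : ℂ))).fun_div (hid1.fun_pow 2)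
          (pow_ne_zero 2 hl1))).mul_const (mu t)).const_sub (mu t ^ 2)).fun_add
        ((hasDerivAt_const (lam t) κ).fun_div (hid.fun_mul hid1) (mul_ne_zero hl0 hl1)))
    have hdl1 := hdlam.sub_const 1
    have hdt : HasDerivAt (fun x : ℝ => (x : ℂ)) 1 t := Complex.ofRealCLM.hasDerivAt
    have hdmu := ((hp t ht).fun_div ((hds.const_mul 2).fun_mul hdl1)
        (mul_ne_zero (mul_ne_zero two_ne_zero hs0) hl1)).fun_add
      (((((hasDerivAt_const t κ₀).fun_div hdlam hl0).fun_add
        ((hasDerivAt_const t θ₁).fun_div hdl1 hl1)).fun_sub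
        ((hdt.const_mul η₁).fun_div (hdl1.fun_pow 2) (pow_ne_zero 2 hl1))).div_const 2)
    rw [← funext hmu] at hdmu
    refine hdmu.congr_deriv ?_
    have hHl' := hHl.deriv
    simp only [id] at hHl'
    simp only [hH]
    rw [hHl', hp', hα, hβ, hγ, hδ, hmu, hlam]
    push_cast
    field_simp
    ring
end

section
/- Let η₀, η∞, θ₀, θ∞ ∈ ℂ and set α = −4η∞θ∞, β = 4η₀(θ₀+1), γ = 4η∞², δ = −4η₀². Let I ⊆ (0,∞) be an open interval and let q, p : I → ℂ be differentiable, satisfying the Hamiltonian system t q'(t) = p(t) and t p'(t) = (α/4)e^{q} + (βt/4)e^{−q} + (γ/4)e^{2q} + (δt²/4)e^{−2q} (the canonical equations t q' = ∂𝓗/∂p, t p' = −∂𝓗/∂q for 𝓗(q,p,t) = p²/2 − (α/4)e^{q} + (βt/4)e^{−q} − (γ/8)e^{2q} + (δt²/8)e^{−2q}). Define λ(t) = exp(q(t)) and μ(t) = p(t)/(2λ(t)) + (1/2)( η∞ + θ₀/λ(t) − η₀ t/λ(t)² ). Then λ and μ are differentiable on I and satisfy λ'(t) = (∂H/∂μ)(λ(t),μ(t),t)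 and μ'(t) = −(∂H/∂λ)(λ(t),μ(t),t) for the polynomial P_III Hamiltonian H(λ,μ,t) = (λ²/t)·[ μ² − ( η∞ + θ₀/λ − η₀ t/λ² )·μ + η∞(θ₀+θ∞)/(2λ) ]. -/
open Complex

/-- The canonical transformation from the Calogero side of P_III (exponential-hyperbolic
model, rank one) to the polynomial Hamiltonian form of P_III. -/
theorem PIII_canonical_transformation
    (η₀ ηinf θ₀ θinf α β γ δ : ℂ)
    (hα : α = -4 * ηinf * θinf) (hβ : β = 4 * η₀ * (θ₀ + 1))
    (hγ : γ = 4 * ηinf ^ 2) (hδ : δ = -4 * η₀ ^ 2)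
    (I : Set ℝ) (hI : IsOpen I) (hIpos : I ⊆ Set.Ioi (0 : ℝ))
    (q p q' p' : ℝ → ℂ)
    (hq : ∀ t ∈ I, HasDerivAt q (q' t) t)
    (hp : ∀ t ∈ I, HasDerivAt p (p' t) t)
    (heq1 : ∀ t ∈ I, (t : ℂ) * q' t = p t)
    (heq2 : ∀ t ∈ I, (t : ℂ) * p' t =
        α / 4 * Complex.exp (q t) + β * (t : ℂ) / 4 * Complex.exp (-q t)
          + γ / 4 * Complex.exp (2 * q t)
          + δ * (t : ℂ) ^ 2 / 4 * Complex.exp (-(2 * q t)))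
    (lam mu : ℝ → ℂ)
    (hlam : ∀ t, lam t = Complex.exp (q t))
    (hmu : ∀ t, mu t = p t / (2 * lam t)
        + (ηinf + θ₀ / lam t - η₀ * (t : ℂ) / lam t ^ 2) / 2)
    (H : ℂ → ℂ → ℝ → ℂ)
    (hH : ∀ l m t, H l m t = l ^ 2 / (t : ℂ) *
        (m ^ 2 - (ηinf + θ₀ / l - η₀ * (t : ℂ) / l ^ 2) * m
          + ηinf * (θ₀ + θinf) / (2 * l))) :
    ∀ t ∈ I,
      HasDerivAt lam (deriv (fun m => H (lam t) m t) (mu t)) t ∧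
      HasDerivAt mu (-deriv (fun l => H l (mu t) t) (lam t)) t := by
  intro t ht
  have ht0 : (t : ℂ) ≠ 0 := by exact_mod_cast (hIpos ht).ne'
  have hl0 : lam t ≠ 0 := by rw [hlam]; exact exp_ne_zero _
  have hlam' : HasDerivAt lam (lam t * q' t) t := by
    rw [hlam, funext hlam]
    exact (hq t ht).cexp
  have hq' : q' t = p t / t := by
    rw [eq_div_iff ht0, ← heq1 t ht, mul_comm]
  have hp' : p' t = (α / 4 * lam t + β * t / 4 / lam t + γ / 4 * lam t ^ 2
      + δ * t ^ 2 / 4 / lam t ^ 2) / t := by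
    rw [eq_div_iff ht0, mul_comm, heq2 t ht, hlam, exp_neg, exp_neg, ← exp_nat_mul]
    push_cast
    simp only [div_eq_mul_inv]
  have hHm : HasDerivAt (fun m => H (lam t) m t)
      (lam t ^ 2 / t * (2 * mu t - (ηinf + θ₀ / lam t - η₀ * t / lam t ^ 2))) (mu t) := by
    simp only [hH]
    have h := ((((hasDerivAt_id (mu t)).pow 2).sub ((hasDerivAt_id (mu t)).const_mul
      (ηinf + θ₀ / lam t - η₀ * t / lam t ^ 2))).add_const
      (ηinf * (θ₀ + θinf) / (2 * lam t))).const_mul (lam t ^ 2 / t)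
    exact h.congr_deriv (by simp)
  have hHl : HasDerivAt (fun l => H l (mu t) t)
      ((2 * lam t * mu t ^ 2 - (2 * ηinf * lam t + θ₀) * mu t
        + ηinf * (θ₀ + θinf) / 2) / t) (lam t) := by
    have h := (((((hasDerivAt_id (lam t)).pow 2).mul_const (mu t ^ 2)).sub
      ((((((hasDerivAt_id (lam t)).pow 2).const_mul ηinf).add
        ((hasDerivAt_id (lam t)).const_mul θ₀)).sub_const (η₀ * t)).mul_const (mu t))).add
      ((hasDerivAt_id (lam t)).const_mul (ηinf * (θ₀ + θinf) / 2))).div_const (t : ℂ)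
    refine (h.congr_of_eventuallyEq ?_).congr_deriv ?_
    · filter_upwards [isOpen_ne.mem_nhds hl0] with l hl
      have hl : l ≠ 0 := hl
      simp [hH]
      field_simp
    · simp
      ring
  have hof : HasDerivAt (fun s : ℝ => (s : ℂ)) 1 t := (hasDerivAt_id t).ofReal_comp
  rw [hHm.deriv, hHl.deriv]
  constructor
  · refine hlam'.congr_deriv ?_
    rw [hq', hmu]
    field_simp
    ring
  · rw [funext hmu]
    have h := ((hp t ht).div (hlam'.const_mul 2) (mul_ne_zero two_ne_zero hl0)).add
      ((((hasDerivAt_const t θ₀).div hlam' hl0).const_add ηinf |>.sub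
        ((hof.const_mul η₀).div (hlam'.pow 2) (pow_ne_zero 2 hl0))).div_const 2)
    refine h.congr_deriv ?_
    rw [hp', hq', hα, hβ, hγ, hδ]
    simp
    field_simp
    ring
end

section
/- Fix an integer ℓ ≥ 1 and constants κ₀, θ₁, η₁, κ, g ∈ ℂ; set α = (κ₀+θ₁)²/2 − 2κ, β = −κ₀²/2, γ = η₁(θ₁+1), δ = −η₁²/2. Let I ⊆ (0,∞) be an open interval and let q_j, p_j : I → ℂ (j = 1,…,ℓ) be differentiable, with sinh(q_j/2) ≠ 0, cosh(q_j/2) ≠ 0 on I for each j, and sinh((q_j−q_k)/2) ≠ 0, sinh((q_j+q_k)/2) ≠ 0 on I for each j ≠ k. Suppose they satisfy the canonical equations t q_j' = (∂𝓗/∂p_j) and t p_j' = −(∂𝓗/∂q_j) for the Hamiltonian 𝓗(q,p,t) = Σ_{j=1}^{ℓ} [ p_j²/2 − α/sinh²(q_j/2) − β/cosh²(q_j/2) + (γt/2)cosh(q_j) + (δt²/8)cosh(2q_j) ] + g² Σ_{j≠k} [ 1/sinh²((q_j−q_k)/2) + 1/sinh²((q_j+q_k)/2) ]. Define s_j = −coth(q_j/2),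 λ_j = s_j², and μ_j = p_j/(2 s_j(λ_j−1)) + (1/2)( κ₀/λ_j + θ₁/(λ_j−1) − η₁ t/(λ_j−1)² ). Then λ_j ≠ λ_k on I for j ≠ k, and the λ_j, μ_j satisfy the canonical equations λ_j' = (∂H/∂μ_j) and μ_j' = −(∂H/∂λ_j) for the multi-component P_V Hamiltonian H(λ,μ,t) = Σ_{j=1}^{ℓ} (λ_j(λ_j−1)²/t)·[ μ_j² − ( κ₀/λ_j + θ₁/(λ_j−1) − η₁ t/(λ_j−1)² )·μ_j + κ/(λ_j(λ_j−1)) ] + (g²/t) Σ_{j≠k} (λ_j−1)(λ_k−1)(λ_j+λ_k)/(λ_j−λ_k)². -/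
open Complex

lemma hasDerivAt_sum_update {n : ℕ} (f : Fin n → ℂ → ℂ) (L : Fin n → ℂ) (j : Fin n) (D : ℂ)
    (h : HasDerivAt (f j) D (L j)) :
    HasDerivAt (fun x => ∑ i, f i (Function.update L j x i)) D (L j) := by
  have key : HasDerivAt (fun x => ∑ i, f i (Function.update L j x i))
      (∑ i, if i = j then D else 0) (L j) := by
    refine HasDerivAt.fun_sum fun i _ => ?_
    by_cases hij : i = j
    · subst hij
      simpa using h
    · simpa [hij] using hasDerivAt_const (L j) (f i (L i))
  simpa using key

lemma hasDerivAt_sum_pair_update {n : ℕ} (F : ℂ → ℂ → ℂ) (hF : ∀ a b, F a b = F b a)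
    (L : Fin n → ℂ) (j : Fin n) (D : Fin n → ℂ)
    (h : ∀ k, k ≠ j → HasDerivAt (fun x => F x (L k)) (D k) (L j)) :
    HasDerivAt (fun x => ∑ i, ∑ k, if i ≠ k then
        F (Function.update L j x i) (Function.update L j x k) else 0)
      (2 * ∑ k, if k ≠ j then D k else 0) (L j) := by
  have key : HasDerivAt (fun x => ∑ i, ∑ k, if i ≠ k then
        F (Function.update L j x i) (Function.update L j x k) else 0)
      (∑ i, ∑ k, ((if i = j then (if k ≠ j then D k else 0) else 0)
        + (if k = j then (if i ≠ j then D i else 0) else 0))) (L j) := by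
    refine HasDerivAt.fun_sum fun i _ => HasDerivAt.fun_sum fun k _ => ?_
    by_cases hik : i = k
    · subst hik
      by_cases hij : i = j <;> simpa [hij] using hasDerivAt_const (L j) (0 : ℂ)
    · by_cases hij : i = j
      · subst hij
        simpa [hik, Ne.symm hik] using h k (Ne.symm hik)
      · by_cases hkj : k = j
        · subst hkj
          simpa [hik, hF (L i)] using h i hik
        · simpa [hik, hij, hkj] using hasDerivAt_const (L j) (F (L i) (L k))
  convert key using 1
  simp only [Finset.sum_add_distrib, Finset.sum_ite_irrel, Finset.sum_const_zero,
    Finset.sum_ite_eq', Finset.mem_univ, if_true]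
  ring

/-- The square of the hyperbolic cotangent of half the argument. -/
noncomputable def cothHalfSq (x : ℂ) : ℂ := (cosh (x / 2) / sinh (x / 2)) ^ 2

lemma cothHalfSq_sub_one {x : ℂ} (h : sinh (x / 2) ≠ 0) :
    cothHalfSq x - 1 = 1 / sinh (x / 2) ^ 2 := by
  have := cosh_sq (x / 2)
  rw [cothHalfSq]
  field_simp
  linear_combination this

lemma hasDerivAt_coth_half {x : ℂ} (h : sinh (x / 2) ≠ 0) :
    HasDerivAt (fun y : ℂ => -(cosh (y / 2) / sinh (y / 2))) ((cothHalfSq x - 1) / 2) x := by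
  have h2 : HasDerivAt (fun y : ℂ => y / 2) (1 / 2) x := (hasDerivAt_id x).div_const 2
  refine (h2.ccosh.div h2.csinh h).neg.congr_deriv ?_
  rw [cothHalfSq_sub_one h]
  have := cosh_sq (x / 2)
  field_simp
  linear_combination this

lemma hasDerivAt_cothHalfSq {x : ℂ} (h : sinh (x / 2) ≠ 0) :
    HasDerivAt cothHalfSq (-(cosh (x / 2) / sinh (x / 2)) * (cothHalfSq x - 1)) x := by
  have e : cothHalfSq = fun y : ℂ => (-(cosh (y / 2) / sinh (y / 2))) ^ 2 := by
    ext y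
    rw [cothHalfSq, neg_sq]
  have := (hasDerivAt_coth_half h).pow 2
  rw [e]
  refine (this.congr_deriv ?_)
  rw [e]
  simp only []
  ring

lemma cothHalfSq_sub {a b : ℂ} (ha : sinh (a / 2) ≠ 0) (hb : sinh (b / 2) ≠ 0) :
    cothHalfSq a - cothHalfSq b
      = -(sinh ((a - b) / 2) * sinh ((a + b) / 2)) / (sinh (a / 2) ^ 2 * sinh (b / 2) ^ 2) := by
  rw [sub_div, add_div, sinh_sub, sinh_add, cothHalfSq, cothHalfSq]
  field_simp
  ring

lemma pair_potential_eq {a b : ℂ} (ha : sinh (a / 2) ≠ 0) (hb : sinh (b / 2) ≠ 0)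
    (h1 : sinh ((a - b) / 2) ≠ 0) (h2 : sinh ((a + b) / 2) ≠ 0) :
    1 / sinh ((a - b) / 2) ^ 2 + 1 / sinh ((a + b) / 2) ^ 2
      = 2 * ((cothHalfSq a - 1) * (cothHalfSq b - 1) * (cothHalfSq a + cothHalfSq b)
        / (cothHalfSq a - cothHalfSq b) ^ 2) := by
  rw [cothHalfSq_sub ha hb, cothHalfSq_sub_one ha, cothHalfSq_sub_one hb, cothHalfSq, cothHalfSq]
  field_simp
  rw [sub_div, add_div, sinh_sub, sinh_add]
  ring

lemma hasDerivAt_pair_rational {a b : ℂ} (h : a ≠ b) :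
    HasDerivAt (fun x => (x - 1) * (b - 1) * (x + b) / (x - b) ^ 2)
      ((b - 1) * ((2 * a + b - 1) / (a - b) ^ 2 - 2 * (a - 1) * (a + b) / (a - b) ^ 3)) a := by
  have h0 : a - b ≠ 0 := sub_ne_zero.2 h
  have h1 := hasDerivAt_id' a
  refine ((((h1.sub_const 1).mul_const (b - 1)).mul (h1.add_const b)).div
    ((h1.sub_const b).pow 2) (pow_ne_zero 2 h0)).congr_deriv ?_
  simp only [Pi.mul_apply, Pi.pow_apply]
  field_simp
  ring

lemma cosh_eq_cothHalfSq {x : ℂ} (h : sinh (x / 2) ≠ 0) :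
    cosh x = (cothHalfSq x + 1) / (cothHalfSq x - 1) := by
  rw [cothHalfSq_sub_one h, cothHalfSq]
  have := cosh_two_mul (x / 2)
  rw [mul_div_cancel₀ x two_ne_zero] at this
  rw [this]
  field_simp

lemma one_body_potential_eq (α β γ δ t : ℂ) {x : ℂ} (h : sinh (x / 2) ≠ 0)
    (hc : cosh (x / 2) ≠ 0) :
    -α / sinh (x / 2) ^ 2 - β / cosh (x / 2) ^ 2 + γ * t / 2 * cosh x
        + δ * t ^ 2 / 8 * cosh (2 * x)
      = -α * (cothHalfSq x - 1) - β * (1 - 1 / cothHalfSq x)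
        + γ * t / 2 * (1 + 2 / (cothHalfSq x - 1))
        + δ * t ^ 2 / 8 * (1 + 8 * (1 / (cothHalfSq x - 1) + 1 / (cothHalfSq x - 1) ^ 2)) := by
  have h2 : cosh (2 * x) = 2 * cosh x ^ 2 - 1 := by
    rw [cosh_two_mul, sinh_sq]
    ring
  have h3 : 1 - 1 / cothHalfSq x = 1 / cosh (x / 2) ^ 2 := by
    have := cosh_sq (x / 2)
    rw [cothHalfSq]
    field_simp
    linear_combination this
  have h4 : cothHalfSq x - 1 ≠ 0 := by
    rw [cothHalfSq_sub_one h]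
    exact div_ne_zero one_ne_zero (pow_ne_zero 2 h)
  have h5 : 1 / sinh (x / 2) ^ 2 = cothHalfSq x - 1 := (cothHalfSq_sub_one h).symm
  have h6 : -α / sinh (x / 2) ^ 2 = -α * (1 / sinh (x / 2) ^ 2) := by ring
  rw [h2, h3, h6, h5, cosh_eq_cothHalfSq h]
  field_simp
  ring

lemma hasDerivAt_one_body_rational (α β γ δ t : ℂ) {a : ℂ} (h0 : a ≠ 0) (h1 : a - 1 ≠ 0) :
    HasDerivAt (fun x => -α * (x - 1) - β * (1 - 1 / x) + γ * t / 2 * (1 + 2 / (x - 1))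
        + δ * t ^ 2 / 8 * (1 + 8 * (1 / (x - 1) + 1 / (x - 1) ^ 2)))
      (-α - β / a ^ 2 - γ * t / (a - 1) ^ 2 - δ * t ^ 2 * (a + 1) / (a - 1) ^ 3) a := by
  have hx := hasDerivAt_id' a
  have hx1 := hx.sub_const 1
  have e1 := hx1.const_mul (-α)
  have e2 := (((hasDerivAt_const a (1 : ℂ)).div hx h0).const_sub 1).const_mul β
  have e3 := (((hasDerivAt_const a (2 : ℂ)).div hx1 h1).const_add 1).const_mul (γ * t / 2)
  have e4 := (((((hasDerivAt_const a (1 : ℂ)).div hx1 h1).add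
    ((hasDerivAt_const a (1 : ℂ)).div (hx1.pow 2) (pow_ne_zero 2 h1))).const_mul 8).const_add
      1).const_mul (δ * t ^ 2 / 8)
  refine (((e1.sub e2).add e3).add e4).congr_deriv ?_
  simp only [Pi.pow_apply]
  field_simp
  ring

lemma hasDerivAt_one_body_PV (κ₀ θ₁ η₁ κ t M : ℂ) (ht : t ≠ 0) {a : ℂ} (h0 : a ≠ 0)
    (h1 : a - 1 ≠ 0) :
    HasDerivAt (fun x => x * (x - 1) ^ 2 / t *
        (M ^ 2 - (κ₀ / x + θ₁ / (x - 1) - η₁ * t / (x - 1) ^ 2) * M + κ / (x * (x - 1))))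
      ((((a - 1) ^ 2 + 2 * a * (a - 1)) * M ^ 2
        - (2 * κ₀ * (a - 1) + θ₁ * (2 * a - 1) - η₁ * t) * M + κ) / t) a := by
  have hx := hasDerivAt_id' a
  have hx1 := hx.sub_const 1
  have e1 := (hx.mul (hx1.pow 2)).div_const t
  have e2 := ((((hasDerivAt_const a κ₀).div hx h0).add ((hasDerivAt_const a θ₁).div hx1 h1)).sub
    ((hasDerivAt_const a (η₁ * t)).div (hx1.pow 2) (pow_ne_zero 2 h1))).mul_const M
  have e3 := (hasDerivAt_const a κ).div (hx.mul hx1) (mul_ne_zero h0 h1)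
  refine (e1.mul ((e2.const_sub (M ^ 2)).add e3)).congr_deriv ?_
  simp only [Pi.pow_apply, Pi.mul_apply, Pi.add_apply, Pi.sub_apply, Pi.div_apply]
  field_simp
  ring

/-- The canonical transformation from the rank-ℓ non-autonomous hyperbolic Inozemtsev
model to the multi-component fifth Painlevé equation. -/
theorem multi_component_PV
    (ℓ : ℕ) (hℓ : 1 ≤ ℓ) (κ₀ θ₁ η₁ κ g α β γ δ : ℂ)
    (hα : α = (κ₀ + θ₁) ^ 2 / 2 - 2 * κ) (hβ : β = -κ₀ ^ 2 / 2)
    (hγ : γ = η₁ * (θ₁ + 1)) (hδ : δ = -η₁ ^ 2 / 2)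
    (I : Set ℝ) (hI : IsOpen I) (hIpos : I ⊆ Set.Ioi (0 : ℝ))
    (q p q' p' : Fin ℓ → ℝ → ℂ)
    (hq : ∀ j, ∀ t ∈ I, HasDerivAt (q j) (q' j t) t)
    (hp : ∀ j, ∀ t ∈ I, HasDerivAt (p j) (p' j t) t)
    (hsinh : ∀ j, ∀ t ∈ I, Complex.sinh (q j t / 2) ≠ 0)
    (hcosh : ∀ j, ∀ t ∈ I, Complex.cosh (q j t / 2) ≠ 0)
    (hd1 : ∀ j k, j ≠ k → ∀ t ∈ I, Complex.sinh ((q j t - q k t) / 2) ≠ 0)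
    (hd2 : ∀ j k, j ≠ k → ∀ t ∈ I, Complex.sinh ((q j t + q k t) / 2) ≠ 0)
    (𝓗 : (Fin ℓ → ℂ) → (Fin ℓ → ℂ) → ℝ → ℂ)
    (h𝓗 : ∀ Q P t, 𝓗 Q P t =
        (∑ j, (P j ^ 2 / 2 - α / Complex.sinh (Q j / 2) ^ 2
            - β / Complex.cosh (Q j / 2) ^ 2
            + γ * (t : ℂ) / 2 * Complex.cosh (Q j)
            + δ * (t : ℂ) ^ 2 / 8 * Complex.cosh (2 * Q j)))
        + g ^ 2 * ∑ j, ∑ k,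
            (if j ≠ k then
              1 / Complex.sinh ((Q j - Q k) / 2) ^ 2
                + 1 / Complex.sinh ((Q j + Q k) / 2) ^ 2
            else 0))
    (hham1 : ∀ j, ∀ t ∈ I, (t : ℂ) * q' j t =
        deriv (fun x => 𝓗 (fun i => q i t) (Function.update (fun i => p i t) j x) t)
          (p j t))
    (hham2 : ∀ j, ∀ t ∈ I, (t : ℂ) * p' j t =
        -deriv (fun x => 𝓗 (Function.update (fun i => q i t) j x) (fun i => p i t) t)
          (q j t))
    (s lam mu : Fin ℓ → ℝ → ℂ)
    (hs : ∀ j t, s j t = -(Complex.cosh (q j t / 2) / Complex.sinh (q j t / 2)))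
    (hlam : ∀ j t, lam j t = s j t ^ 2)
    (hmu : ∀ j t, mu j t = p j t / (2 * s j t * (lam j t - 1))
        + (κ₀ / lam j t + θ₁ / (lam j t - 1)
            - η₁ * (t : ℂ) / (lam j t - 1) ^ 2) / 2)
    (H : (Fin ℓ → ℂ) → (Fin ℓ → ℂ) → ℝ → ℂ)
    (hH : ∀ L M t, H L M t =
        (∑ j, L j * (L j - 1) ^ 2 / (t : ℂ) *
            (M j ^ 2 - (κ₀ / L j + θ₁ / (L j - 1)
                - η₁ * (t : ℂ) / (L j - 1) ^ 2) * M j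
              + κ / (L j * (L j - 1))))
        + g ^ 2 / (t : ℂ) * ∑ j, ∑ k,
            (if j ≠ k then
              (L j - 1) * (L k - 1) * (L j + L k) / (L j - L k) ^ 2
            else 0)) :
    (∀ j k, j ≠ k → ∀ t ∈ I, lam j t ≠ lam k t) ∧
    (∀ j, ∀ t ∈ I,
      HasDerivAt (lam j)
        (deriv (fun x => H (fun i => lam i t) (Function.update (fun i => mu i t) j x) t)
          (mu j t)) t
      ∧ HasDerivAt (mu j)
        (-deriv (fun x => H (Function.update (fun i => lam i t) j x) (fun i => mu i t) t)
          (lam j t)) t) := by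
  have hlam' : ∀ j t, lam j t = cothHalfSq (q j t) := fun j t => by
    rw [hlam, hs, neg_sq, cothHalfSq]
  have hne : ∀ j k, j ≠ k → ∀ t ∈ I, lam j t ≠ lam k t := by
    intro j k hjk t ht
    rw [← sub_ne_zero, hlam', hlam', cothHalfSq_sub (hsinh j t ht) (hsinh k t ht)]
    exact div_ne_zero (neg_ne_zero.2 (mul_ne_zero (hd1 j k hjk t ht) (hd2 j k hjk t ht)))
      (mul_ne_zero (pow_ne_zero 2 (hsinh j t ht)) (pow_ne_zero 2 (hsinh k t ht)))
  refine ⟨hne, fun j t ht => ?_⟩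
  have htc : (t : ℂ) ≠ 0 := by exact_mod_cast (hIpos ht).ne'
  have hsh := hsinh j t ht
  have hch := hcosh j t ht
  have hs0 : s j t ≠ 0 := by
    rw [hs]
    exact neg_ne_zero.2 (div_ne_zero hch hsh)
  have hl0 : lam j t ≠ 0 := by
    rw [hlam]
    exact pow_ne_zero 2 hs0
  have hl1 : lam j t - 1 ≠ 0 := by
    rw [hlam', cothHalfSq_sub_one hsh]
    exact div_ne_zero one_ne_zero (pow_ne_zero 2 hsh)
  have hqp : (t : ℂ) * q' j t = p j t := by
    rw [hham1 j t ht]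
    refine HasDerivAt.deriv ?_
    simp only [h𝓗]
    refine (HasDerivAt.add_const _ (hasDerivAt_sum_update (fun i y =>
      y ^ 2 / 2 - α / sinh (q i t / 2) ^ 2 - β / cosh (q i t / 2) ^ 2
        + γ * (t : ℂ) / 2 * cosh (q i t) + δ * (t : ℂ) ^ 2 / 8 * cosh (2 * q i t))
      (fun i => p i t) j (p j t) ?_))
    refine (((((((hasDerivAt_id' (p j t)).pow 2).div_const 2).sub_const _).sub_const _).add_const
      _).add_const _).congr_deriv ?_
    simp
  obtain ⟨C, hC⟩ : ∃ C : Fin ℓ → ℂ, C = fun k => (lam k t - 1) *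
      ((2 * lam j t + lam k t - 1) / (lam j t - lam k t) ^ 2
        - 2 * (lam j t - 1) * (lam j t + lam k t) / (lam j t - lam k t) ^ 3) := ⟨_, rfl⟩
  have hCd : ∀ k, k ≠ j → HasDerivAt
      (fun x => (x - 1) * (lam k t - 1) * (x + lam k t) / (x - lam k t) ^ 2) (C k) (lam j t) := by
    intro k hk
    rw [hC]
    exact hasDerivAt_pair_rational (hne j k hk.symm t ht)
  have hLq : HasDerivAt cothHalfSq (s j t * (lam j t - 1)) (q j t) := by
    rw [hlam', hs]
    exact hasDerivAt_cothHalfSq hsh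
  have hev : ∀ᶠ x in nhds (q j t), sinh (x / 2) ≠ 0 ∧ cosh (x / 2) ≠ 0 := by
    refine (ContinuousAt.eventually_ne (g := fun x : ℂ => sinh (x / 2)) (by fun_prop) hsh).and
      (ContinuousAt.eventually_ne (g := fun x : ℂ => cosh (x / 2)) (by fun_prop) hch)
  have hpq : (t : ℂ) * p' j t = -((-α - β / lam j t ^ 2 - γ * t / (lam j t - 1) ^ 2
        - δ * t ^ 2 * (lam j t + 1) / (lam j t - 1) ^ 3) * (s j t * (lam j t - 1))
      + g ^ 2 * (4 * (s j t * (lam j t - 1)) * ∑ k, if k ≠ j then C k else 0)) := by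
    rw [hham2 j t ht]
    congr 1
    refine HasDerivAt.deriv ?_
    simp only [h𝓗]
    refine HasDerivAt.add ?_ (HasDerivAt.const_mul _ ?_)
    · refine hasDerivAt_sum_update (fun i y =>
        p i t ^ 2 / 2 - α / sinh (y / 2) ^ 2 - β / cosh (y / 2) ^ 2
          + γ * (t : ℂ) / 2 * cosh y + δ * (t : ℂ) ^ 2 / 8 * cosh (2 * y))
        (fun i => q i t) j _ ?_
      have hU := hasDerivAt_one_body_rational α β γ δ t hl0 hl1
      rw [hlam'] at hU
      refine (((HasDerivAt.comp _ hU hLq).const_add (p j t ^ 2 / 2)).congr_of_eventuallyEq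
        ?_).congr_deriv (by rw [hlam'])
      filter_upwards [hev] with x hx
      have := one_body_potential_eq α β γ δ t hx.1 hx.2
      simp only [Function.comp]
      rw [← this]
      ring
    · have hpair := hasDerivAt_sum_pair_update
        (fun a b => 1 / sinh ((a - b) / 2) ^ 2 + 1 / sinh ((a + b) / 2) ^ 2)
        (fun a b => by
          rw [← neg_sub b a, neg_div, sinh_neg, neg_sq, add_comm b a])
        (fun i => q i t) j (fun k => 2 * (C k * (s j t * (lam j t - 1)))) ?_
      · refine hpair.congr_deriv ?_
        rw [Finset.mul_sum, Finset.mul_sum]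
        refine Finset.sum_congr rfl fun k _ => ?_
        split_ifs <;> ring
      · intro k hk
        have hD := hCd k hk
        rw [hlam' j] at hD
        refine ((HasDerivAt.comp _ hD hLq).const_mul 2).congr_of_eventuallyEq ?_
        have e1 := ContinuousAt.eventually_ne (g := fun x : ℂ => sinh ((x - q k t) / 2))
          (x := q j t) (by fun_prop) (hd1 j k hk.symm t ht)
        have e2 := ContinuousAt.eventually_ne (g := fun x : ℂ => sinh ((x + q k t) / 2))
          (x := q j t) (by fun_prop) (hd2 j k hk.symm t ht)
        filter_upwards [hev, e1, e2] with x hx h1 h2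
        simp only [Function.comp]
        rw [pair_potential_eq hx.1 (hsinh k t ht) h1 h2, hlam' k]
  have hHmu : deriv (fun x => H (fun i => lam i t) (Function.update (fun i => mu i t) j x) t)
      (mu j t) = lam j t * (lam j t - 1) ^ 2 / t * (2 * mu j t
        - (κ₀ / lam j t + θ₁ / (lam j t - 1) - η₁ * (t : ℂ) / (lam j t - 1) ^ 2)) := by
    refine HasDerivAt.deriv ?_
    simp only [hH]
    refine HasDerivAt.add_const _ (hasDerivAt_sum_update (fun i y =>
      lam i t * (lam i t - 1) ^ 2 / (t : ℂ) *
            (y ^ 2 - (κ₀ / lam i t + θ₁ / (lam i t - 1)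
                - η₁ * (t : ℂ) / (lam i t - 1) ^ 2) * y
              + κ / (lam i t * (lam i t - 1)))) (fun i => mu i t) j _ ?_)
    have hy := hasDerivAt_id' (mu j t)
    refine ((((hy.pow 2).sub (hy.const_mul _)).add_const _).const_mul _).congr_deriv ?_
    simp
  have hHlam : deriv (fun x => H (Function.update (fun i => lam i t) j x) (fun i => mu i t) t)
      (lam j t) = (((lam j t - 1) ^ 2 + 2 * lam j t * (lam j t - 1)) * mu j t ^ 2
        - (2 * κ₀ * (lam j t - 1) + θ₁ * (2 * lam j t - 1) - η₁ * t) * mu j t + κ) / t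
        + g ^ 2 / t * (2 * ∑ k, if k ≠ j then C k else 0) := by
    refine HasDerivAt.deriv ?_
    simp only [hH]
    refine HasDerivAt.add ?_ (HasDerivAt.const_mul _ ?_)
    · exact hasDerivAt_sum_update (fun i y => y * (y - 1) ^ 2 / (t : ℂ) *
            (mu i t ^ 2 - (κ₀ / y + θ₁ / (y - 1)
                - η₁ * (t : ℂ) / (y - 1) ^ 2) * mu i t
              + κ / (y * (y - 1)))) (fun i => lam i t) j _
        (hasDerivAt_one_body_PV κ₀ θ₁ η₁ κ t (mu j t) htc hl0 hl1)
    · exact hasDerivAt_sum_pair_update (fun a b => (a - 1) * (b - 1) * (a + b) / (a - b) ^ 2)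
        (fun a b => by
          rw [← neg_sub b a, neg_sq]
          ring) (fun i => lam i t) j C hCd
  have hsd : HasDerivAt (s j) ((lam j t - 1) / 2 * q' j t) t := by
    have e : s j = (fun y : ℂ => -(cosh (y / 2) / sinh (y / 2))) ∘ q j := funext fun u => hs j u
    rw [e, hlam']
    exact HasDerivAt.comp t (hasDerivAt_coth_half hsh) (hq j t ht)
  have hld : HasDerivAt (lam j) (s j t * (lam j t - 1) * q' j t) t := by
    have e : lam j = fun u => s j u ^ 2 := funext fun u => hlam j u
    rw [e]
    refine (hsd.pow 2).congr_deriv ?_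
    simp only [hlam]
    ring
  have hq' : q' j t = p j t / t := by
    rw [← hqp]
    field_simp
  have hp' := eq_div_of_mul_eq htc ((mul_comm _ _).trans hpq)
  have hls := hlam j t
  rw [hHmu, hHlam]
  constructor
  · refine hld.congr_deriv ?_
    rw [hq', hmu]
    rw [hls] at hl1 ⊢
    field_simp
    ring
  · have e : mu j = fun u => p j u / (2 * s j u * (lam j u - 1))
        + (κ₀ / lam j u + θ₁ / (lam j u - 1)
            - η₁ * (u : ℂ) / (lam j u - 1) ^ 2) / 2 := funext fun u => hmu j u
    have htd : HasDerivAt (fun u : ℝ => (u : ℂ)) 1 t := ofRealCLM.hasDerivAt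
    have hl1d := hld.sub_const 1
    have d1 := (hp j t ht).div ((hsd.const_mul 2).mul hl1d)
      (mul_ne_zero (mul_ne_zero two_ne_zero hs0) hl1)
    have d2 := (hasDerivAt_const t κ₀).div hld hl0
    have d3 := (hasDerivAt_const t θ₁).div hl1d hl1
    have d4 := (htd.const_mul η₁).div (hl1d.pow 2) (pow_ne_zero 2 hl1)
    have d := d1.add (((d2.add d3).sub d4).div_const 2)
    rw [e]
    refine d.congr_deriv ?_
    simp only [Pi.pow_apply, Pi.mul_apply]
    rw [hp', hq', hα, hβ, hγ, hδ]
    generalize (∑ k, if k ≠ j then C k else 0) = S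
    generalize s j t = σ at *
    rw [hls] at hl1 ⊢
    generalize p j t = P
    generalize (t : ℂ) = τ at *
    clear * - hs0 hl1 htc
    field_simp
    ring
end

section
/- Fix an integer ℓ ≥ 1 and constants κ₀, θ∞, g ∈ ℂ; set α = 2θ∞ − κ₀ + 1 and β = −2κ₀². Let I ⊆ ℝ be an open interval and let q_j, p_j : I → ℂ (j = 1,…,ℓ) be differentiable with q_j ≠ 0 on I for each j and q_j ≠ q_k, q_j ≠ −q_k on I for each j ≠ k. Suppose they satisfy the canonical equations q_j' = (∂𝓗/∂p_j) and p_j' = −(∂𝓗/∂q_j) for the Hamiltonian 𝓗(q,p,t) = Σ_{j=1}^{ℓ} [ p_j²/2 − (1/2)(q_j/2)⁶ − 2t(q_j/2)⁴ − 2(t² − α)(q_j/2)² + β(q_j/2)⁻² ] + g² Σ_{j≠k} [ 1/(q_j−q_k)² + 1/(q_j+q_k)² ]. Define λ_j = (q_j/2)² and μ_j = p_j/(2q_j) + (1/4)( λ_j + 2t + 2κ₀/λ_j ). Then λ_j ≠ λ_k on I for j ≠ k, and the λ_j, μ_j satisfy the canonical equations λ_j' = (∂H/∂μ_j) and μ_j'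 = −(∂H/∂λ_j) for the multi-component P_IV Hamiltonian H(λ,μ,t) = Σ_{j=1}^{ℓ} 2λ_j·[ μ_j² − ( λ_j/2 + t + κ₀/λ_j )·μ_j + θ∞/2 ] + (g²/8) Σ_{j≠k} (λ_j+λ_k)/(λ_j−λ_k)². -/
open Complex

/-- Differentiating a sum of one-variable terms in a single coordinate. -/
lemma hasDerivAt_sum_update_s9 {ι : Type*} [Fintype ι] [DecidableEq ι] (F : ι → ℂ → ℂ)
    (v : ι → ℂ) (j : ι) {d : ℂ} (h : HasDerivAt (F j) d (v j)) :
    HasDerivAt (fun x => ∑ i, F i (Function.update v j x i)) d (v j) := by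
  have key : HasDerivAt (fun x => ∑ i, F i (Function.update v j x i))
      (∑ i, if i = j then d else 0) (v j) := by
    refine HasDerivAt.fun_sum fun i _ => ?_
    rcases eq_or_ne i j with rfl | hij
    · simpa using h
    · simpa [hij] using hasDerivAt_const (v j) (F i (v i))
  simpa using key

/-- Differentiating a symmetric pair interaction in a single coordinate. -/
lemma hasDerivAt_sum_sum_update {ι : Type*} [Fintype ι] [DecidableEq ι] (f : ℂ → ℂ → ℂ)
    (hf : ∀ x y, f x y = f y x) (v d : ι → ℂ) (j : ι)
    (h : ∀ k, j ≠ k → HasDerivAt (fun x => f x (v k)) (d k) (v j)) :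
    HasDerivAt (fun x => ∑ i, ∑ k,
        if i ≠ k then f (Function.update v j x i) (Function.update v j x k) else 0)
      (2 * ∑ k, if j ≠ k then d k else 0) (v j) := by
  have key : HasDerivAt (fun x => ∑ i, ∑ k,
        if i ≠ k then f (Function.update v j x i) (Function.update v j x k) else 0)
      (∑ i, ∑ k, ((if i = j then (if j ≠ k then d k else 0) else 0)
        + (if k = j then (if j ≠ i then d i else 0) else 0))) (v j) := by
    refine HasDerivAt.fun_sum fun i _ => HasDerivAt.fun_sum fun k _ => ?_
    rcases eq_or_ne i k with rfl | hik
    · rcases eq_or_ne i j with rfl | hij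
      · simpa using hasDerivAt_const (v i) (0 : ℂ)
      · simpa [hij] using hasDerivAt_const (v j) (0 : ℂ)
    · rcases eq_or_ne i j with rfl | hij
      · simpa [hik, hik.symm] using h k hik
      · rcases eq_or_ne k j with rfl | hkj
        · simpa [hij, hij.symm, hf] using h i hij.symm
        · simpa [hik, hij, hkj] using hasDerivAt_const (v j) (f (v i) (v k))
  refine key.congr_deriv ?_
  simp only [Finset.sum_add_distrib, Finset.sum_ite_eq', Finset.mem_univ, if_true]
  rw [Finset.sum_comm]
  simp only [Finset.sum_ite_eq', Finset.mem_univ, if_true, two_mul]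

/-- The derivative of the rational Inozemtsev one-particle potential. -/
lemma hasDerivAt_inozemtsev_potential (c s a b x : ℂ) (hx : x ≠ 0) :
    HasDerivAt (fun x : ℂ => c - (1 / 2) * (x / 2) ^ 6 - 2 * s * (x / 2) ^ 4
        - 2 * (s ^ 2 - a) * (x / 2) ^ 2 + b / (x / 2) ^ 2)
      (-(3 / 2) * (x / 2) ^ 5 - 4 * s * (x / 2) ^ 3 - 2 * (s ^ 2 - a) * (x / 2)
        - b / (x / 2) ^ 3) x := by
  have h2 : HasDerivAt (fun x : ℂ => x / 2) (1 / 2) x := (hasDerivAt_id x).div_const 2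
  have hne : x / 2 ≠ 0 := div_ne_zero hx two_ne_zero
  refine (((((hasDerivAt_const x c).fun_sub ((h2.fun_pow 6).const_mul (1 / 2))).fun_sub
    ((h2.fun_pow 4).const_mul (2 * s))).fun_sub ((h2.fun_pow 2).const_mul (2 * (s ^ 2 - a)))).fun_add
    ((hasDerivAt_const x b).fun_div (h2.fun_pow 2) (pow_ne_zero 2 hne))).congr_deriv ?_
  field_simp
  push_cast
  ring

/-- The derivative of the rational Inozemtsev pair potential. -/
lemma hasDerivAt_inozemtsev_pair (x y : ℂ) (h1 : x - y ≠ 0) (h2 : x + y ≠ 0) :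
    HasDerivAt (fun x : ℂ => 1 / (x - y) ^ 2 + 1 / (x + y) ^ 2)
      (-2 / (x - y) ^ 3 - 2 / (x + y) ^ 3) x := by
  have e1 := (hasDerivAt_const x (1 : ℂ)).fun_div (((hasDerivAt_id' x).sub_const y).fun_pow 2)
    (pow_ne_zero 2 h1)
  have e2 := (hasDerivAt_const x (1 : ℂ)).fun_div (((hasDerivAt_id' x).add_const y).fun_pow 2)
    (pow_ne_zero 2 h2)
  refine (e1.fun_add e2).congr_deriv ?_
  field_simp
  push_cast
  ring

/-- The derivative in `x` of the one-particle fourth Painlevé Hamiltonian. -/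
lemma hasDerivAt_painleveIV_position (m s k θ x : ℂ) (hx : x ≠ 0) :
    HasDerivAt (fun x : ℂ => 2 * x * (m ^ 2 - (x / 2 + s + k / x) * m + θ / 2))
      (2 * m ^ 2 - (2 * x + 2 * s) * m + θ) x := by
  have e := ((hasDerivAt_id' x).const_mul 2).fun_mul ((((hasDerivAt_const x (m ^ 2)).fun_sub
    (((((hasDerivAt_id' x).div_const 2).add_const s).fun_add
      ((hasDerivAt_const x k).fun_div (hasDerivAt_id' x) hx)).mul_const m))).add_const (θ / 2))
  refine e.congr_deriv ?_
  field_simp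
  ring

/-- The derivative in `m` of the one-particle fourth Painlevé Hamiltonian. -/
lemma hasDerivAt_painleveIV_momentum (x w θ m : ℂ) :
    HasDerivAt (fun m : ℂ => 2 * x * (m ^ 2 - w * m + θ / 2)) (2 * x * (2 * m - w)) m := by
  have e := ((((hasDerivAt_id' m).fun_pow 2).fun_sub ((hasDerivAt_id' m).const_mul w)).add_const
    (θ / 2)).const_mul (2 * x)
  refine e.congr_deriv ?_
  push_cast
  ring

/-- The derivative of the pair term of the multi-component fourth Painlevé Hamiltonian. -/
lemma hasDerivAt_painleveIV_pair (x y : ℂ) (h : x - y ≠ 0) :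
    HasDerivAt (fun x : ℂ => (x + y) / (x - y) ^ 2) (-(x + 3 * y) / (x - y) ^ 3) x := by
  refine (((hasDerivAt_id' x).add_const y).fun_div (((hasDerivAt_id' x).sub_const y).fun_pow 2)
    (pow_ne_zero 2 h)).congr_deriv ?_
  field_simp
  push_cast
  ring

/-- The pair forces of the two models agree under `λ = (q / 2) ^ 2`. -/
lemma inozemtsev_pair_force (x y : ℂ) (hx : x ≠ 0) (h1 : x - y ≠ 0) (h2 : x + y ≠ 0) :
    (-2 / (x - y) ^ 3 - 2 / (x + y) ^ 3) / x
      = 1 / 4 * (-((x / 2) ^ 2 + 3 * (y / 2) ^ 2) / ((x / 2) ^ 2 - (y / 2) ^ 2) ^ 3) := by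
  have h : (x / 2) ^ 2 - (y / 2) ^ 2 = (x - y) * (x + y) / 4 := by ring
  rw [h]
  field_simp
  ring

/-- The canonical transformation from the rank-ℓ non-autonomous rational Inozemtsev
model to the multi-component fourth Painlevé equation. -/
theorem multi_component_PIV
    (ℓ : ℕ) (hℓ : 1 ≤ ℓ) (κ₀ θinf g α β : ℂ)
    (hα : α = 2 * θinf - κ₀ + 1) (hβ : β = -2 * κ₀ ^ 2)
    (I : Set ℝ) (hI : IsOpen I)
    (q p q' p' : Fin ℓ → ℝ → ℂ)
    (hq : ∀ j, ∀ t ∈ I, HasDerivAt (q j) (q' j t) t)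
    (hp : ∀ j, ∀ t ∈ I, HasDerivAt (p j) (p' j t) t)
    (hqne : ∀ j, ∀ t ∈ I, q j t ≠ 0)
    (hd1 : ∀ j k, j ≠ k → ∀ t ∈ I, q j t ≠ q k t)
    (hd2 : ∀ j k, j ≠ k → ∀ t ∈ I, q j t ≠ -q k t)
    (𝓗 : (Fin ℓ → ℂ) → (Fin ℓ → ℂ) → ℝ → ℂ)
    (h𝓗 : ∀ Q P t, 𝓗 Q P t =
        (∑ j, (P j ^ 2 / 2 - (1 / 2) * (Q j / 2) ^ 6 - 2 * (t : ℂ) * (Q j / 2) ^ 4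
            - 2 * ((t : ℂ) ^ 2 - α) * (Q j / 2) ^ 2 + β / (Q j / 2) ^ 2))
        + g ^ 2 * ∑ j, ∑ k,
            (if j ≠ k then
              1 / (Q j - Q k) ^ 2 + 1 / (Q j + Q k) ^ 2
            else 0))
    (hham1 : ∀ j, ∀ t ∈ I, q' j t =
        deriv (fun x => 𝓗 (fun i => q i t) (Function.update (fun i => p i t) j x) t)
          (p j t))
    (hham2 : ∀ j, ∀ t ∈ I, p' j t =
        -deriv (fun x => 𝓗 (Function.update (fun i => q i t) j x) (fun i => p i t) t)
          (q j t))
    (lam mu : Fin ℓ → ℝ → ℂ)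
    (hlam : ∀ j t, lam j t = (q j t / 2) ^ 2)
    (hmu : ∀ j t, mu j t = p j t / (2 * q j t)
        + (lam j t + 2 * (t : ℂ) + 2 * κ₀ / lam j t) / 4)
    (H : (Fin ℓ → ℂ) → (Fin ℓ → ℂ) → ℝ → ℂ)
    (hH : ∀ L M t, H L M t =
        (∑ j, 2 * L j *
            (M j ^ 2 - (L j / 2 + (t : ℂ) + κ₀ / L j) * M j + θinf / 2))
        + g ^ 2 / 8 * ∑ j, ∑ k,
            (if j ≠ k then (L j + L k) / (L j - L k) ^ 2 else 0)) :
    (∀ j k, j ≠ k → ∀ t ∈ I, lam j t ≠ lam k t) ∧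
    (∀ j, ∀ t ∈ I,
      HasDerivAt (lam j)
        (deriv (fun x => H (fun i => lam i t) (Function.update (fun i => mu i t) j x) t)
          (mu j t)) t
      ∧ HasDerivAt (mu j)
        (-deriv (fun x => H (Function.update (fun i => lam i t) j x) (fun i => mu i t) t)
          (lam j t)) t) := by
  have hsub : ∀ j k, j ≠ k → ∀ t ∈ I, q j t - q k t ≠ 0 := fun j k hjk t ht =>
    sub_ne_zero.2 (hd1 j k hjk t ht)
  have hadd : ∀ j k, j ≠ k → ∀ t ∈ I, q j t + q k t ≠ 0 := fun j k hjk t ht h =>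
    hd2 j k hjk t ht (eq_neg_of_add_eq_zero_left h)
  have hlne : ∀ j k, j ≠ k → ∀ t ∈ I, lam j t ≠ lam k t := by
    intro j k hjk t ht h
    refine mul_ne_zero (hsub j k hjk t ht) (hadd j k hjk t ht) ?_
    rw [hlam, hlam] at h
    linear_combination 4 * h
  refine ⟨hlne, fun j t ht => ?_⟩
  have hqj := hqne j t ht
  have hl0 : lam j t ≠ 0 := by
    rw [hlam]
    exact pow_ne_zero 2 (div_ne_zero hqj two_ne_zero)
  have hq'j : q' j t = p j t := by
    rw [hham1 j t ht]
    refine HasDerivAt.deriv ?_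
    simp only [h𝓗]
    refine HasDerivAt.add_const _ ?_
    refine hasDerivAt_sum_update_s9 (fun i y => y ^ 2 / 2 - (1 / 2) * (q i t / 2) ^ 6
      - 2 * (t : ℂ) * (q i t / 2) ^ 4 - 2 * ((t : ℂ) ^ 2 - α) * (q i t / 2) ^ 2
      + β / (q i t / 2) ^ 2) (fun i => p i t) j ?_
    have e := (((((((hasDerivAt_id' (p j t)).fun_pow 2).div_const 2).sub_const
      ((1 / 2) * (q j t / 2) ^ 6)).sub_const (2 * (t : ℂ) * (q j t / 2) ^ 4)).sub_const
      (2 * ((t : ℂ) ^ 2 - α) * (q j t / 2) ^ 2)).add_const (β / (q j t / 2) ^ 2))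
    refine e.congr_deriv ?_
    push_cast
    ring
  have hp'j := hham2 j t ht
  rw [HasDerivAt.deriv (f' := (-(3 / 2) * (q j t / 2) ^ 5 - 4 * (t : ℂ) * (q j t / 2) ^ 3
      - 2 * ((t : ℂ) ^ 2 - α) * (q j t / 2) - β / (q j t / 2) ^ 3)
      + g ^ 2 * (2 * ∑ k, if j ≠ k then
        (-2 / (q j t - q k t) ^ 3 - 2 / (q j t + q k t) ^ 3) else 0))
    (by
      simp only [h𝓗]
      refine HasDerivAt.fun_add ?_ (HasDerivAt.const_mul _ ?_)
      · exact hasDerivAt_sum_update_s9 (fun i y => p i t ^ 2 / 2 - (1 / 2) * (y / 2) ^ 6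
          - 2 * (t : ℂ) * (y / 2) ^ 4 - 2 * ((t : ℂ) ^ 2 - α) * (y / 2) ^ 2
          + β / (y / 2) ^ 2) (fun i => q i t) j
          (hasDerivAt_inozemtsev_potential _ _ _ _ _ hqj)
      · exact hasDerivAt_sum_sum_update (fun x y => 1 / (x - y) ^ 2 + 1 / (x + y) ^ 2)
          (fun x y => by rw [sub_sq_comm, add_comm x y]) (fun i => q i t)
          (fun k => -2 / (q j t - q k t) ^ 3 - 2 / (q j t + q k t) ^ 3) j
          (fun k hjk => hasDerivAt_inozemtsev_pair _ _ (hsub j k hjk t ht)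
            (hadd j k hjk t ht)))] at hp'j
  have hHmu : deriv (fun x => H (fun i => lam i t)
      (Function.update (fun i => mu i t) j x) t) (mu j t)
      = 2 * lam j t * (2 * mu j t - (lam j t / 2 + (t : ℂ) + κ₀ / lam j t)) := by
    refine HasDerivAt.deriv ?_
    simp only [hH]
    refine HasDerivAt.add_const _ ?_
    exact hasDerivAt_sum_update_s9 (fun i y => 2 * lam i t *
      (y ^ 2 - (lam i t / 2 + (t : ℂ) + κ₀ / lam i t) * y + θinf / 2)) (fun i => mu i t) j
      (hasDerivAt_painleveIV_momentum _ _ _ _)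
  have hHlam : deriv (fun x => H (Function.update (fun i => lam i t) j x)
      (fun i => mu i t) t) (lam j t)
      = (2 * mu j t ^ 2 - (2 * lam j t + 2 * (t : ℂ)) * mu j t + θinf)
        + g ^ 2 / 8 * (2 * ∑ k, if j ≠ k then
          -(lam j t + 3 * lam k t) / (lam j t - lam k t) ^ 3 else 0) := by
    refine HasDerivAt.deriv ?_
    simp only [hH]
    refine HasDerivAt.fun_add ?_ (HasDerivAt.const_mul _ ?_)
    · exact hasDerivAt_sum_update_s9 (fun i y => 2 * y *
        (mu i t ^ 2 - (y / 2 + (t : ℂ) + κ₀ / y) * mu i t + θinf / 2)) (fun i => lam i t) j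
        (hasDerivAt_painleveIV_position _ _ _ _ _ hl0)
    · exact hasDerivAt_sum_sum_update (fun x y => (x + y) / (x - y) ^ 2)
        (fun x y => by rw [sub_sq_comm, add_comm x y]) (fun i => lam i t)
        (fun k => -(lam j t + 3 * lam k t) / (lam j t - lam k t) ^ 3) j
        (fun k hjk => hasDerivAt_painleveIV_pair _ _ (sub_ne_zero.2 (hlne j k hjk t ht)))
  have hforce : (∑ k, if j ≠ k then
        (-2 / (q j t - q k t) ^ 3 - 2 / (q j t + q k t) ^ 3) else 0)
      = q j t * (1 / 4 * ∑ k, if j ≠ k then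
          -(lam j t + 3 * lam k t) / (lam j t - lam k t) ^ 3 else 0) := by
    rw [Finset.mul_sum, Finset.mul_sum]
    refine Finset.sum_congr rfl fun k _ => ?_
    split_ifs with hjk
    · rw [hlam, hlam, ← inozemtsev_pair_force _ _ hqj (hsub j k hjk t ht)
        (hadd j k hjk t ht), mul_div_cancel₀ _ hqj]
    · simp
  rw [hforce] at hp'j
  have hlamD : HasDerivAt (lam j) (q j t * p j t / 2) t := by
    rw [funext (hlam j)]
    refine (((hq j t ht).div_const 2).fun_pow 2).congr_deriv ?_
    rw [hq'j]
    push_cast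
    ring
  have ht' : HasDerivAt (fun s : ℝ => (s : ℂ)) 1 t := Complex.ofRealCLM.hasDerivAt
  rw [hHmu, hHlam]
  generalize (∑ k, if j ≠ k then
    -(lam j t + 3 * lam k t) / (lam j t - lam k t) ^ 3 else 0) = S at hp'j ⊢
  constructor
  · refine hlamD.congr_deriv ?_
    rw [hmu, hlam]
    field_simp
    ring
  · have e := ((hp j t ht).fun_div ((hq j t ht).const_mul 2)
      (mul_ne_zero two_ne_zero hqj)).fun_add (((hlamD.fun_add (ht'.const_mul 2)).fun_add
      ((hasDerivAt_const t (2 * κ₀)).fun_div hlamD hl0)).div_const 4)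
    rw [funext (hmu j)]
    refine e.congr_deriv ?_
    simp only [hp'j, hq'j, hlam, hα, hβ]
    field_simp
    ring
end
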